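/- Let n ≥ 6, and for R > 1 set U := U[−Re₁,1], V := U[Re₁,1] (where e₁ = (1,0,…,0)) and f := (U+V)^p − U^p − V^p. There exists a constant C(n) > 1 such that for all sufficiently large R, C(n)⁻¹ g_n(R) ≤ ‖f‖_{L²(ℝⁿ)} ≤ C(n) g_n(R), where g_n(R) := R^{−4} if n = 6, R^{−5} if n = 7, R^{−6}(log R)^{1/2} if n = 8, and R^{−(n+4)/2} if n > 8. -/

import Mathlib

/-!
Two-sided estimate for the `L²` norm of `f = (U+V)^p - U^p - V^p` for two distant bubbles.
-/

open MeasureTheory Filter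

noncomputable section

abbrev Rn (n : ℕ) := EuclideanSpace ℝ (Fin n)

/-- The exponent `p = (n+2)/(n-2)`. -/
def pExp (n : ℕ) : ℝ := ((n : ℝ) + 2) / ((n : ℝ) - 2)

/-- The Talenti bubble `U[z,λ]`. -/
def talenti (n : ℕ) (z : Rn n) (lam : ℝ) (x : Rn n) : ℝ :=
  ((n : ℝ) * ((n : ℝ) - 2)) ^ (((n : ℝ) - 2) / 4) * lam ^ (((n : ℝ) - 2) / 2) *
    (1 + lam ^ 2 * ‖x - z‖ ^ 2) ^ (-(((n : ℝ) - 2) / 2))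

/-- The `L^q` norm. -/
def LpNorm (n : ℕ) (q : ℝ) (f : Rn n → ℝ) : ℝ :=
  (∫ x : Rn n, |f x| ^ q) ^ (1 / q)

/-- The first vector of the canonical basis, `e₁ = (1,0,…,0)`. -/
def eOne (n : ℕ) : Rn n :=
  (EuclideanSpace.equiv (Fin n) ℝ).symm fun i => if (i : ℕ) = 0 then 1 else 0

/-- The interaction error `f = (U+V)^p - U^p - V^p` with `U = U[-Re₁,1]`, `V = U[Re₁,1]`. -/
def bigF (n : ℕ) (R : ℝ) (x : Rn n) : ℝ :=
  (talenti n (-(R • eOne n)) 1 x + talenti n (R • eOne n) 1 x) ^ pExp n -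
    talenti n (-(R • eOne n)) 1 x ^ pExp n - talenti n (R • eOne n) 1 x ^ pExp n

/-- The asymptotic profile `g_n(R)` of `‖f‖_{L²}`. -/
def gFun (n : ℕ) (R : ℝ) : ℝ :=
  if n = 6 then R ^ (-(4 : ℝ))
  else if n = 7 then R ^ (-(5 : ℝ))
  else if n = 8 then R ^ (-(6 : ℝ)) * Real.sqrt (Real.log R)
  else R ^ (-(((n : ℝ) + 4) / 2))

lemma aux_F {p a b : ℝ} (hp : 1 < p) (hb : 0 < b) (hab : b ≤ a) :
    (p - 1) * (a ^ (p - 1) * b) ≤ (a + b) ^ p - a ^ p - b ^ p ∧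
    (a + b) ^ p - a ^ p - b ^ p ≤ 2 ^ p * (a ^ (p - 1) * b) := by
  have ha : 0 < a := hb.trans_le hab
  have hap : a ^ p = a ^ (p - 1) * a := by
    rw [← Real.rpow_add_one ha.ne']; simp
  have hbp : b ^ p = b ^ (p - 1) * b := by
    rw [← Real.rpow_add_one hb.ne']; simp
  have hbp0 : 0 < b ^ p := Real.rpow_pos_of_pos hb _
  have hap0 : 0 < a ^ (p - 1) := Real.rpow_pos_of_pos ha _
  set t := b / a with ht
  have ht0 : 0 < t := by positivity
  have ht1 : t ≤ 1 := by rw [ht, div_le_one ha]; exact hab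
  have hbt : b = t * a := by rw [ht]; field_simp
  have hsum : (a + b) ^ p = a ^ (p - 1) * a * (1 + t) ^ p := by
    rw [← hap, ← Real.mul_rpow ha.le (by positivity)]
    congr 1; rw [hbt]; ring
  constructor
  · have h1 := one_add_mul_self_le_rpow_one_add (s := t) (by linarith) hp.le
    have h2 : b ^ p ≤ a ^ (p - 1) * b := by
      rw [hbp]
      exact mul_le_mul_of_nonneg_right (Real.rpow_le_rpow hb.le hab (by linarith)) hb.le
    have h3 : a ^ (p - 1) * a * (1 + p * t) ≤ (a + b) ^ p := by
      rw [hsum]; gcongr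
    have h4 : a ^ (p - 1) * a * (1 + p * t) = a ^ p + p * (a ^ (p - 1) * b) := by
      rw [hap, hbt]; ring
    linarith
  · have hc := (convexOn_rpow hp.le).2 (show (1 : ℝ) ∈ Set.Ici 0 by simp)
      (show (2 : ℝ) ∈ Set.Ici 0 by simp) (by linarith : 0 ≤ 1 - t) ht0.le (by ring)
    simp only [smul_eq_mul, Real.one_rpow] at hc
    have h1 : (1 + t) ^ p ≤ 1 + 2 ^ p * t := by
      have : (1 - t) * 1 + t * 2 = 1 + t := by ring
      rw [this] at hc
      linarith
    have h3 : (a + b) ^ p ≤ a ^ (p - 1) * a * (1 + 2 ^ p * t) := by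
      rw [hsum]; gcongr
    have h4 : a ^ (p - 1) * a * (1 + 2 ^ p * t) = a ^ p + 2 ^ p * (a ^ (p - 1) * b) := by
      rw [hap, hbt]; ring
    linarith

/-- two-bubble quantity as a function of distances -/
def FF (c m p s t : ℝ) : ℝ :=
  (c * (1 + s ^ 2) ^ (-m) + c * (1 + t ^ 2) ^ (-m)) ^ p - (c * (1 + s ^ 2) ^ (-m)) ^ p
    - (c * (1 + t ^ 2) ^ (-m)) ^ p

lemma FF_comm (c m p s t : ℝ) : FF c m p s t = FF c m p t s := by
  unfold FF; rw [add_comm]; ring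

lemma FF_bd {c m p s t : ℝ} (hc : 0 < c) (hm : 0 < m) (hp : 1 < p) (hmp : m * (p - 1) = 2)
    (hs : 0 ≤ s) (hst : s ≤ t) :
    ((p - 1) * c ^ p) * ((1 + s ^ 2) ^ (-2 : ℝ) * (1 + t ^ 2) ^ (-m)) ≤ FF c m p s t ∧
    FF c m p s t ≤ (2 ^ p * c ^ p) * ((1 + s ^ 2) ^ (-2 : ℝ) * (1 + t ^ 2) ^ (-m)) := by
  have h := aux_F (p := p) (a := c * (1 + s ^ 2) ^ (-m)) (b := c * (1 + t ^ 2) ^ (-m)) hp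
    (by positivity) (by
      refine mul_le_mul_of_nonneg_left ?_ hc.le
      exact Real.rpow_le_rpow_of_nonpos (by positivity) (by gcongr) (by linarith))
  have e : (c * (1 + s ^ 2) ^ (-m)) ^ (p - 1) * (c * (1 + t ^ 2) ^ (-m)) =
      c ^ p * ((1 + s ^ 2) ^ (-2 : ℝ) * (1 + t ^ 2) ^ (-m)) := by
    rw [Real.mul_rpow hc.le (by positivity), ← Real.rpow_mul (by positivity), neg_mul, hmp]
    have : c ^ p = c ^ (p - 1) * c := by
      rw [← Real.rpow_add_one hc.ne']; simp
    rw [this]; ring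
  rw [e] at h
  unfold FF
  constructor
  · linarith [h.1]
  · linarith [h.2]

lemma w_le {s m : ℝ} (hs : 0 < s) (hm : 0 < m) : (1 + s ^ 2) ^ (-m) ≤ s ^ (-(2 * m)) := by
  have : s ^ (-(2 * m)) = (s ^ 2) ^ (-m) := by
    rw [← Real.rpow_natCast, ← Real.rpow_mul hs.le]; congr 1; push_cast; ring
  rw [this]
  exact Real.rpow_le_rpow_of_nonpos (by positivity) (by linarith) (by linarith)

lemma le_w {s m k : ℝ} {r : ℝ} (hr : 0 < r) (hm : 0 < m) (hk : 0 < k)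
    (h : 1 + s ^ 2 ≤ k * r ^ 2) :
    k ^ (-m) * r ^ (-(2 * m)) ≤ (1 + s ^ 2) ^ (-m) := by
  have : r ^ (-(2 * m)) = (r ^ 2) ^ (-m) := by
    rw [← Real.rpow_natCast, ← Real.rpow_mul hr.le]; congr 1; push_cast; ring
  rw [this, ← Real.mul_rpow hk.le (by positivity)]
  exact Real.rpow_le_rpow_of_nonpos (by positivity) h (by linarith)

def ind (S : Set ℝ) (φ : ℝ → ℝ) (r : ℝ) : ℝ := S.indicator φ r

def HH (m R r : ℝ) : ℝ :=
  ind (Set.Iic 1) (fun _ => R ^ (-(4 * m))) r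
    + ind (Set.Ioc 1 R) (fun r => R ^ (-(4 * m)) * r ^ (-8 : ℝ)) r
    + ind (Set.Ioi R) (fun r => r ^ (-(8 + 4 * m))) r

lemma FF_upper {c m p s t R : ℝ} (hc : 0 < c) (hm : 0 < m) (hp : 1 < p) (hmp : m * (p - 1) = 2)
    (hs : 0 ≤ s) (hst : s ≤ t) (hR : 1 < R) (ht : R ≤ t) :
    (FF c m p s t) ^ 2 ≤ (2 ^ p * c ^ p) ^ 2 * HH m R s := by
  obtain ⟨h1, h2⟩ := FF_bd hc hm hp hmp hs hst
  have h0 : 0 ≤ FF c m p s t := le_trans (by have : 0 < p - 1 := by linarith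
                                             positivity) h1
  have hR0 : 0 < R := by linarith
  have key : ((1 + s ^ 2) ^ (-2 : ℝ) * (1 + t ^ 2) ^ (-m)) ^ 2 ≤ HH m R s := by
    have ht' : (1 + t ^ 2) ^ (-m) ≤ R ^ (-(2 * m)) := by
      refine le_trans (w_le (by linarith) hm) ?_
      exact Real.rpow_le_rpow_of_nonpos hR0 ht (by linarith)
    have eR : R ^ (-(4 * m)) = (R ^ (-(2 * m))) ^ 2 := by
      rw [← Real.rpow_natCast, ← Real.rpow_mul hR0.le]; congr 1; push_cast; ring
    unfold HH ind
    rcases le_or_gt s 1 with h | h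
    · have a1 : s ∈ Set.Iic (1 : ℝ) := h
      have a2 : s ∉ Set.Ioc 1 R := fun h' => absurd h'.1 (not_lt.2 h)
      have a3 : s ∉ Set.Ioi R := fun h' => by have := Set.mem_Ioi.1 h'; linarith
      simp only [Set.indicator_of_mem a1, Set.indicator_of_notMem a2,
        Set.indicator_of_notMem a3, add_zero, eR]
      have : (1 + s ^ 2) ^ (-2 : ℝ) ≤ 1 :=
        Real.rpow_le_one_of_one_le_of_nonpos (by nlinarith) (by norm_num)
      have := mul_le_mul this ht' (by positivity) (by norm_num)
      rw [one_mul] at this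
      gcongr
    · have hs0 : 0 < s := by linarith
      have a1 : s ∉ Set.Iic (1 : ℝ) := fun h' => absurd h (not_lt.2 h')
      have hw := w_le hs0 (m := 2) (by norm_num)
      have e2 : s ^ (-8 : ℝ) = (s ^ (-(2 * 2) : ℝ)) ^ 2 := by
        rw [← Real.rpow_natCast, ← Real.rpow_mul hs0.le]; congr 1; norm_num
      rcases le_or_gt s R with h' | h'
      · have a2 : s ∈ Set.Ioc 1 R := ⟨h, h'⟩
        have a3 : s ∉ Set.Ioi R := not_lt.2 h'
        simp only [Set.indicator_of_notMem a1, Set.indicator_of_mem a2,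
          Set.indicator_of_notMem a3, add_zero, zero_add, eR, e2]
        rw [← mul_pow, mul_comm (R ^ _)]
        gcongr
      · have a2 : s ∉ Set.Ioc 1 R := fun h'' => absurd h' (not_lt.2 h''.2)
        have a3 : s ∈ Set.Ioi R := h'
        simp only [Set.indicator_of_notMem a1, Set.indicator_of_notMem a2,
          Set.indicator_of_mem a3, zero_add]
        have e3 : s ^ (-(8 + 4 * m)) = (s ^ (-(2 * 2) : ℝ) * s ^ (-(2 * m))) ^ 2 := by
          rw [← Real.rpow_add hs0, ← Real.rpow_natCast, ← Real.rpow_mul hs0.le]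
          congr 1; push_cast; ring
        rw [e3]
        have : (1 + t ^ 2) ^ (-m) ≤ s ^ (-(2 * m)) := by
          refine le_trans (w_le (by linarith) hm) ?_
          exact Real.rpow_le_rpow_of_nonpos hs0 hst (by linarith)
        gcongr
  calc (FF c m p s t) ^ 2
      ≤ ((2 ^ p * c ^ p) * ((1 + s ^ 2) ^ (-2 : ℝ) * (1 + t ^ 2) ^ (-m))) ^ 2 := by gcongr
    _ = (2 ^ p * c ^ p) ^ 2 * ((1 + s ^ 2) ^ (-2 : ℝ) * (1 + t ^ 2) ^ (-m)) ^ 2 := by ring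
    _ ≤ _ := by gcongr

lemma FF_lower {c m p s t R : ℝ} (hc : 0 < c) (hm : 0 < m) (hp : 1 < p) (hmp : m * (p - 1) = 2)
    (hs : 0 ≤ s) (hst : s ≤ t) (hR : 1 < R) (ht : t ≤ 3 * R) :
    ((p - 1) * c ^ p * ((2 : ℝ) ^ (-2 : ℝ) * 10 ^ (-m))) ^ 2 *
      ind (Set.Ioc 1 R) (fun r => R ^ (-(4 * m)) * r ^ (-8 : ℝ)) s ≤ (FF c m p s t) ^ 2 := by
  obtain ⟨h1, h2⟩ := FF_bd hc hm hp hmp hs hst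
  unfold ind
  by_cases h : s ∈ Set.Ioc 1 R
  swap
  · rw [Set.indicator_of_notMem h, mul_zero]; positivity
  have hp' : 0 < p - 1 := by linarith
  have hR0 : 0 < R := by linarith
  have hs0 : 0 < s := by linarith [h.1]
  have e2 : s ^ (-8 : ℝ) = (s ^ (-(2 * 2) : ℝ)) ^ 2 := by
    rw [← Real.rpow_natCast, ← Real.rpow_mul hs0.le]; congr 1; norm_num
  have eR : R ^ (-(4 * m)) = (R ^ (-(2 * m))) ^ 2 := by
    rw [← Real.rpow_natCast, ← Real.rpow_mul hR0.le]; congr 1; push_cast; ring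
  rw [Set.indicator_of_mem h, e2, eR, ← mul_pow, ← mul_pow]
  refine pow_le_pow_left₀ (by positivity) (le_trans ?_ h1) 2
  have k1 := le_w (s := s) (r := s) (m := 2) (k := 2) hs0 (by norm_num) (by norm_num)
    (by nlinarith [h.1])
  have k2 := le_w (s := t) (r := R) (m := m) (k := 10) hR0 hm (by norm_num)
    (by nlinarith [h.1])
  calc _ = (p - 1) * c ^ p * (((2 : ℝ) ^ (-2 : ℝ) * s ^ (-(2 * 2) : ℝ)) *
      (10 ^ (-m) * R ^ (-(2 * m)))) := by ring
    _ ≤ _ := by gcongr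

lemma rad_int (n : ℕ) (hn : 6 ≤ n) {S : Set ℝ} (hS : MeasurableSet S) (φ : ℝ → ℝ) :
    ∫ x : Rn n, ind S φ ‖x‖ = (n * volume.real (Metric.ball (0 : Rn n) 1)) *
      ∫ r in Set.Ioi 0 ∩ S, r ^ (n - 1) * φ r := by
  have : Nonempty (Fin n) := ⟨⟨0, by omega⟩⟩
  rw [integral_fun_norm_addHaar volume (ind S φ)]
  simp only [finrank_euclideanSpace, Fintype.card_fin, nsmul_eq_mul, smul_eq_mul]
  rw [mul_assoc, ← setIntegral_indicator hS]
  congr 3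
  ext r
  unfold ind
  by_cases h : r ∈ S <;> simp [h]

lemma rad_integrable (n : ℕ) (hn : 6 ≤ n) {S : Set ℝ} (hS : MeasurableSet S) (φ : ℝ → ℝ)
    (h : IntegrableOn (fun r => r ^ (n - 1) * φ r) (Set.Ioi 0 ∩ S)) :
    Integrable (fun x : Rn n => ind S φ ‖x‖) := by
  have : Nonempty (Fin n) := ⟨⟨0, by omega⟩⟩
  rw [integrable_fun_norm_addHaar volume (f := ind S φ)]
  simp only [finrank_euclideanSpace, Fintype.card_fin, smul_eq_mul]
  rw [IntegrableOn, Set.inter_comm, ← Measure.restrict_restrict hS] at h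
  replace h := (integrable_indicator_iff hS).2 h
  rw [IntegrableOn]
  refine h.congr (Filter.Eventually.of_forall fun r => ?_)
  unfold ind
  by_cases hr : r ∈ S <;> simp [hr]

def LL (n : ℕ) (R : ℝ) : ℝ := ∫ r in (1 : ℝ)..R, r ^ ((n : ℝ) - 9)

lemma pow_comb (n : ℕ) (hn : 6 ≤ n) {r : ℝ} (hr : 0 < r) (a : ℝ) :
    r ^ (n - 1) * r ^ a = r ^ ((n : ℝ) - 1 + a) := by
  rw [← Real.rpow_natCast, ← Real.rpow_add hr, Nat.cast_sub (by omega)]; simp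

lemma piece1 (n : ℕ) (hn : 6 ≤ n) (A : ℝ) :
    Integrable (fun x : Rn n => ind (Set.Iic 1) (fun _ => A) ‖x‖) ∧
    ∫ x : Rn n, ind (Set.Iic 1) (fun _ => A) ‖x‖ =
      (n * volume.real (Metric.ball (0 : Rn n) 1)) * (A / n) := by
  have hI : Set.Ioi (0 : ℝ) ∩ Set.Iic 1 = Set.Ioc 0 1 := rfl
  constructor
  · apply rad_integrable n hn measurableSet_Iic
    rw [hI, ← intervalIntegrable_iff_integrableOn_Ioc_of_le (by norm_num)]
    exact Continuous.intervalIntegrable (by fun_prop) _ _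
  · rw [rad_int n hn measurableSet_Iic, hI, ← intervalIntegral.integral_of_le (by norm_num),
      intervalIntegral.integral_mul_const, integral_pow]
    congr 1
    have : ((n - 1 : ℕ) : ℝ) + 1 = n := by
      rw [Nat.cast_sub (by omega)]; simp
    rw [this, one_pow, zero_pow (by omega)]
    ring

lemma piece2 (n : ℕ) (hn : 6 ≤ n) (A : ℝ) {R : ℝ} (hR : 1 < R) :
    Integrable (fun x : Rn n => ind (Set.Ioc 1 R) (fun r => A * r ^ (-8 : ℝ)) ‖x‖) ∧
    ∫ x : Rn n, ind (Set.Ioc 1 R) (fun r => A * r ^ (-8 : ℝ)) ‖x‖ =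
      (n * volume.real (Metric.ball (0 : Rn n) 1)) * (A * LL n R) := by
  have hI : Set.Ioi (0 : ℝ) ∩ Set.Ioc 1 R = Set.Ioc 1 R := by
    apply Set.inter_eq_right.2
    intro x hx
    exact lt_trans one_pos hx.1
  have hE : Set.EqOn (fun r : ℝ => r ^ (n - 1) * (A * r ^ (-8 : ℝ)))
      (fun r => A * r ^ ((n : ℝ) - 9)) (Set.Ioc 1 R) := by
    intro r hr
    have hr0 : 0 < r := lt_trans one_pos hr.1
    have := pow_comb n hn hr0 (-8)
    simp only
    rw [mul_left_comm, this]; congr 2; ring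
  have h0 : (0 : ℝ) ∉ Set.uIcc 1 R := by
    apply Set.notMem_uIcc_of_lt <;> linarith
  constructor
  · apply rad_integrable n hn measurableSet_Ioc
    rw [hI, integrableOn_congr_fun hE measurableSet_Ioc,
      ← intervalIntegrable_iff_integrableOn_Ioc_of_le hR.le]
    exact (intervalIntegral.intervalIntegrable_rpow (Or.inr h0)).const_mul A
  · rw [rad_int n hn measurableSet_Ioc, hI, setIntegral_congr_fun measurableSet_Ioc hE,
      ← intervalIntegral.integral_of_le hR.le, intervalIntegral.integral_const_mul]
    rfl

lemma piece3 (n : ℕ) (hn : 6 ≤ n) {R : ℝ} (hR : 1 < R) {m : ℝ} (hm : 2 * m = n - 2) :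
    Integrable (fun x : Rn n => ind (Set.Ioi R) (fun r => r ^ (-(8 + 4 * m))) ‖x‖) ∧
    ∫ x : Rn n, ind (Set.Ioi R) (fun r => r ^ (-(8 + 4 * m))) ‖x‖ =
      (n * volume.real (Metric.ball (0 : Rn n) 1)) * (R ^ (-((n : ℝ) + 4)) / (n + 4)) := by
  have hI : Set.Ioi (0 : ℝ) ∩ Set.Ioi R = Set.Ioi R := by
    apply Set.inter_eq_right.2
    intro x hx
    exact lt_trans (by linarith) (Set.mem_Ioi.1 hx)
  have hE : Set.EqOn (fun r : ℝ => r ^ (n - 1) * r ^ (-(8 + 4 * m)))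
      (fun r => r ^ (-((n : ℝ) + 5))) (Set.Ioi R) := by
    intro r hr
    have hr0 : 0 < r := lt_trans (by linarith) (Set.mem_Ioi.1 hr)
    simp only
    rw [pow_comb n hn hr0]; congr 1; linarith
  have hlt : -((n : ℝ) + 5) < -1 := by
    have : (0 : ℝ) ≤ n := by positivity
    linarith
  constructor
  · apply rad_integrable n hn measurableSet_Ioi
    rw [hI, integrableOn_congr_fun hE measurableSet_Ioi]
    exact integrableOn_Ioi_rpow_of_lt hlt (by linarith)
  · rw [rad_int n hn measurableSet_Ioi, hI, setIntegral_congr_fun measurableSet_Ioi hE,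
      integral_Ioi_rpow_of_lt hlt (by linarith)]
    congr 1
    have : -((n : ℝ) + 5) + 1 = -(n + 4) := by ring
    rw [this, neg_div_neg_eq]

lemma HH_int (n : ℕ) (hn : 6 ≤ n) {R : ℝ} (hR : 1 < R) {m : ℝ} (hm : 2 * m = n - 2) :
    Integrable (fun x : Rn n => HH m R ‖x‖) ∧
    ∫ x : Rn n, HH m R ‖x‖ = (n * volume.real (Metric.ball (0 : Rn n) 1)) *
      (R ^ (-(4 * m)) / n + R ^ (-(4 * m)) * LL n R + R ^ (-((n : ℝ) + 4)) / (n + 4)) := by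
  obtain ⟨a1, b1⟩ := piece1 n hn (R ^ (-(4 * m)))
  obtain ⟨a2, b2⟩ := piece2 n hn (R ^ (-(4 * m))) hR
  obtain ⟨a3, b3⟩ := piece3 n hn hR hm
  unfold HH
  refine ⟨(a1.add a2).add a3, ?_⟩
  have a12 := a1.add a2
  simp only [Pi.add_def] at a12
  rw [integral_add a12 a3, integral_add a1 a2, b1, b2, b3]
  ring

lemma g_sq (n : ℕ) (hn : 6 ≤ n) {m : ℝ} (hm : 2 * m = n - 2) {R : ℝ} (hR : 3 ≤ R) :
    0 ≤ gFun n R ∧ (gFun n R) ^ 2 = R ^ (-(4 * m)) *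
      (if n ≤ 7 then 1 else if n = 8 then Real.log R else R ^ ((n : ℝ) - 8)) := by
  have hR0 : 0 < R := by linarith
  have hlog : 0 ≤ Real.log R := Real.log_nonneg (by linarith)
  have hsq : ∀ a : ℝ, (R ^ a) ^ 2 = R ^ (2 * a) := by
    intro a
    rw [← Real.rpow_natCast, ← Real.rpow_mul hR0.le]; congr 1; push_cast; ring
  unfold gFun
  split_ifs with h1 h2 h3 h4 h5 h6 h7 h8 <;> first | omega | skip
  · refine ⟨by positivity, ?_⟩
    subst h1; push_cast at hm
    rw [hsq, mul_one]; congr 1; linarith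
  · refine ⟨by positivity, ?_⟩
    obtain rfl : n = 7 := by assumption
    push_cast at hm
    rw [hsq, mul_one]; congr 1; linarith
  · refine ⟨by positivity, ?_⟩
    obtain rfl : n = 8 := by assumption
    push_cast at hm
    rw [mul_pow, hsq, Real.sq_sqrt hlog]; congr 2; linarith
  · refine ⟨by positivity, ?_⟩
    rw [hsq, ← Real.rpow_add hR0]; congr 1; linarith

lemma log_three_ge : 1 ≤ Real.log 3 := by
  rw [Real.le_log_iff_exp_le (by norm_num)]
  linarith [Real.exp_one_lt_d9]

lemma K_bd (n : ℕ) (hn : 6 ≤ n) : ∃ C : ℝ, 0 < C ∧ ∀ R : ℝ, 3 ≤ R →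
    LL n R ≤ C * (if n ≤ 7 then 1 else if n = 8 then Real.log R else R ^ ((n : ℝ) - 8)) ∧
    (if n ≤ 7 then 1 else if n = 8 then Real.log R else R ^ ((n : ℝ) - 8)) ≤ C * LL n R ∧
    1 ≤ (if n ≤ 7 then 1 else if n = 8 then Real.log R else R ^ ((n : ℝ) - 8)) ∧
    R ^ ((n : ℝ) - 8) ≤
      (if n ≤ 7 then 1 else if n = 8 then Real.log R else R ^ ((n : ℝ) - 8)) := by
  have hLL : n ≠ 8 → ∀ R : ℝ, 3 ≤ R → LL n R = (R ^ ((n : ℝ) - 8) - 1) / ((n : ℝ) - 8) := by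
    intro h R hR
    have h0 : (0 : ℝ) ∉ Set.uIcc 1 R := by
      apply Set.notMem_uIcc_of_lt <;> linarith
    unfold LL
    rw [integral_rpow (Or.inr ⟨?_, h0⟩)]
    · rw [Real.one_rpow, show (n : ℝ) - 9 + 1 = (n : ℝ) - 8 by ring]
    · intro h'
      apply h
      have : (n : ℝ) = 8 := by linarith
      exact_mod_cast this
  rcases lt_trichotomy n 8 with h | h | h
  · have h7 : n ≤ 7 := by omega
    simp only [h7, if_true]
    refine ⟨3, by norm_num, fun R hR => ?_⟩
    rw [hLL h.ne R hR]
    have hR0 : 0 < R := by linarith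
    have hle : R ^ ((n : ℝ) - 8) ≤ 3⁻¹ := by
      have hn7 : (n : ℝ) - 8 ≤ -1 := by
        have : (n : ℝ) ≤ 7 := by exact_mod_cast h7
        linarith
      calc R ^ ((n : ℝ) - 8) ≤ R ^ (-1 : ℝ) :=
            Real.rpow_le_rpow_of_exponent_le (by linarith) hn7
        _ = R⁻¹ := Real.rpow_neg_one R
        _ ≤ 3⁻¹ := by gcongr
    have hp : 0 < R ^ ((n : ℝ) - 8) := by positivity
    generalize R ^ ((n : ℝ) - 8) = K at hle hp ⊢
    refine ⟨?_, ?_, le_refl _, by linarith⟩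
    · have : n = 6 ∨ n = 7 := by omega
      rcases this with rfl | rfl <;> norm_num at hle hp ⊢ <;> linarith
    · have : n = 6 ∨ n = 7 := by omega
      rcases this with rfl | rfl <;> norm_num at hle hp ⊢ <;> linarith
  · subst h
    refine ⟨1, by norm_num, fun R hR => ?_⟩
    have hl : LL 8 R = Real.log R := by
      unfold LL
      have : ∀ r : ℝ, r ^ (((8 : ℕ) : ℝ) - 9) = r⁻¹ := by
        intro r
        rw [← Real.rpow_neg_one]; norm_num
      simp only [this]
      rw [integral_inv_of_pos one_pos (by linarith), div_one]
    have hlog : 1 ≤ Real.log R := log_three_ge.trans (Real.log_le_log (by norm_num) hR)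
    rw [hl]
    simp [hlog]
  · have h7 : ¬ n ≤ 7 := by omega
    have h8 : ¬ n = 8 := by omega
    simp only [h7, h8, if_false]
    have hN : (1 : ℝ) ≤ (n : ℝ) - 8 := by
      have : (9 : ℝ) ≤ n := by exact_mod_cast h
      linarith
    refine ⟨2 * ((n : ℝ) - 8), by linarith, fun R hR => ?_⟩
    rw [hLL h8 R hR]
    have h3 : 3 ≤ R ^ ((n : ℝ) - 8) := by
      calc (3 : ℝ) ≤ R := hR
        _ = R ^ (1 : ℝ) := (Real.rpow_one R).symm
        _ ≤ _ := Real.rpow_le_rpow_of_exponent_le (by linarith) hN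
    set K := R ^ ((n : ℝ) - 8)
    refine ⟨?_, ?_, by linarith, le_refl _⟩
    · rw [div_le_iff₀ (by linarith)]
      nlinarith [mul_nonneg (by linarith : 0 ≤ K) (by nlinarith : 0 ≤ ((n : ℝ) - 8) ^ 2 - 1)]
    · have : 2 * ((n : ℝ) - 8) * ((K - 1) / ((n : ℝ) - 8)) = 2 * (K - 1) := by
        have : (n : ℝ) - 8 ≠ 0 := by linarith
        field_simp
      rw [this]; linarith

lemma g_bd (n : ℕ) (hn : 6 ≤ n) {m : ℝ} (hm : 2 * m = n - 2) :
    ∃ C : ℝ, 0 < C ∧ ∀ R : ℝ, 3 ≤ R → 0 ≤ gFun n R ∧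
      R ^ (-(4 * m)) * LL n R ≤ C * gFun n R ^ 2 ∧
      gFun n R ^ 2 ≤ C * (R ^ (-(4 * m)) * LL n R) ∧
      R ^ (-(4 * m)) ≤ gFun n R ^ 2 ∧ R ^ (-((n : ℝ) + 4)) ≤ gFun n R ^ 2 := by
  obtain ⟨C, hC, h⟩ := K_bd n hn
  refine ⟨C, hC, fun R hR => ?_⟩
  obtain ⟨h1, h2, h3, h4⟩ := h R hR
  obtain ⟨g0, g2⟩ := g_sq n hn hm hR
  have hR0 : 0 < R := by linarith
  have hA : 0 < R ^ (-(4 * m)) := by positivity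
  rw [g2]
  generalize (if n ≤ 7 then 1 else if n = 8 then Real.log R else R ^ ((n : ℝ) - 8)) = K at *
  refine ⟨g0, ?_, ?_, ?_, ?_⟩
  · nlinarith
  · nlinarith
  · nlinarith
  · have : R ^ (-((n : ℝ) + 4)) = R ^ (-(4 * m)) * R ^ ((n : ℝ) - 8) := by
      rw [← Real.rpow_add hR0]; congr 1; linarith
    rw [this]; gcongr

lemma norm_eOne (n : ℕ) (hn : 6 ≤ n) : ‖eOne n‖ = 1 := by
  have : eOne n = EuclideanSpace.single (⟨0, by omega⟩ : Fin n) (1 : ℝ) := by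
    ext i
    simp [eOne, Fin.ext_iff]
  rw [this]; simp

lemma bigF_eq (n : ℕ) (R : ℝ) (x : Rn n) :
    bigF n R x = FF (((n : ℝ) * ((n : ℝ) - 2)) ^ (((n : ℝ) - 2) / 4)) (((n : ℝ) - 2) / 2)
      (pExp n) ‖x + R • eOne n‖ ‖x - R • eOne n‖ := by
  unfold bigF talenti FF
  simp

lemma tri (n : ℕ) (hn : 6 ≤ n) {R : ℝ} (hR : 0 < R) (x : Rn n) :
    2 * R ≤ ‖x + R • eOne n‖ + ‖x - R • eOne n‖ ∧
    ‖x - R • eOne n‖ ≤ ‖x + R • eOne n‖ + 2 * R := by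
  have h : ‖(2 * R) • eOne n‖ = 2 * R := by
    rw [norm_smul, norm_eOne n hn, Real.norm_eq_abs, abs_of_pos (by linarith), mul_one]
  constructor
  · have := norm_sub_le (x + R • eOne n) (x - R • eOne n)
    have e : (x + R • eOne n) - (x - R • eOne n) = (2 * R) • eOne n := by
      rw [mul_smul, two_smul]; abel
    rw [e, h] at this; exact this
  · have := norm_sub_le (x + R • eOne n) ((2 * R) • eOne n)
    have e : (x + R • eOne n) - (2 * R) • eOne n = x - R • eOne n := by
      rw [mul_smul, two_smul]; abel
    rw [e, h] at this; exact this

lemma FF_zero_ge {m R s : ℝ} (hR : 1 < R) (hs : 0 ≤ s) : 0 ≤ HH m R s := by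
  unfold HH ind
  have : ∀ (S : Set ℝ) (φ : ℝ → ℝ), (∀ r, 0 ≤ r → 0 ≤ φ r) → 0 ≤ S.indicator φ s := by
    intro S φ h
    by_cases hh : s ∈ S
    · rw [Set.indicator_of_mem hh]; exact h s hs
    · rw [Set.indicator_of_notMem hh]
  have hR0 : 0 < R := by linarith
  refine add_nonneg (add_nonneg (this _ _ ?_) (this _ _ ?_)) (this _ _ ?_) <;>
    intro r hr <;> positivity

theorem stmt10 (n : ℕ) (hn : 6 ≤ n) :
    ∃ C : ℝ, 1 < C ∧ ∃ R₀ : ℝ, 1 < R₀ ∧ ∀ R : ℝ, R₀ ≤ R →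
      C⁻¹ * gFun n R ≤ LpNorm n 2 (bigF n R) ∧ LpNorm n 2 (bigF n R) ≤ C * gFun n R := by
  have hN : (6 : ℝ) ≤ n := by exact_mod_cast hn
  obtain ⟨c, hc_def⟩ : ∃ c, c = ((n : ℝ) * ((n : ℝ) - 2)) ^ (((n : ℝ) - 2) / 4) := ⟨_, rfl⟩
  have hc : 0 < c := by
    rw [hc_def]
    exact Real.rpow_pos_of_pos (mul_pos (by linarith) (by linarith)) _
  obtain ⟨m, hm_def⟩ : ∃ m, m = ((n : ℝ) - 2) / 2 := ⟨_, rfl⟩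
  have hm : 0 < m := by rw [hm_def]; linarith
  have hm2 : 2 * m = n - 2 := by rw [hm_def]; ring
  obtain ⟨p, hp_def⟩ : ∃ p, p = pExp n := ⟨_, rfl⟩
  have hp1 : p - 1 = 4 / ((n : ℝ) - 2) := by
    have : (n : ℝ) - 2 ≠ 0 := by linarith
    rw [hp_def]; unfold pExp; field_simp; ring
  have hp : 1 < p := by
    have : 0 < 4 / ((n : ℝ) - 2) := div_pos (by norm_num) (by linarith)
    linarith
  have hmp : m * (p - 1) = 2 := by
    have : (n : ℝ) - 2 ≠ 0 := by linarith
    rw [hp1, hm_def]; field_simp; norm_num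
  have hF : ∀ R x, bigF n R x = FF c m p ‖x + R • eOne n‖ ‖x - R • eOne n‖ := by
    intro R x; rw [bigF_eq, hc_def, hm_def, hp_def]
  obtain ⟨C, hC, hg⟩ := g_bd n hn hm2
  set W : ℝ := n * volume.real (Metric.ball (0 : Rn n) 1) with hW_def
  have hW : 0 < W := by
    refine mul_pos (by linarith) ?_
    exact ENNReal.toReal_pos (Metric.measure_ball_pos volume _ one_pos).ne'
      measure_ball_lt_top.ne
  set D : ℝ := (2 ^ p * c ^ p) ^ 2 with hD_def
  have hD : 0 < D := by positivity
  set E : ℝ := ((p - 1) * c ^ p * ((2 : ℝ) ^ (-2 : ℝ) * 10 ^ (-m))) ^ 2 with hE_def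
  have hE : 0 < E := by
    have : 0 < p - 1 := by linarith
    positivity
  -- squared estimates
  have main : ∀ R : ℝ, 3 ≤ R →
      E * (W * (C⁻¹ * gFun n R ^ 2)) ≤ ∫ x : Rn n, bigF n R x ^ 2 ∧
      ∫ x : Rn n, bigF n R x ^ 2 ≤ 2 * D * (W * ((2 + C) * gFun n R ^ 2)) := by
    intro R hR
    obtain ⟨g0, g1, g2, g3, g4⟩ := hg R hR
    have hR1 : 1 < R := by linarith
    have hR0 : 0 < R := by linarith
    obtain ⟨i1, i2⟩ := HH_int n hn hR1 hm2
    have j1 := i1.comp_add_right (R • eOne n)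
    have j2 := i1.comp_sub_right (R • eOne n)
    have k1 := integral_add_right_eq_self (μ := volume) (fun x : Rn n => HH m R ‖x‖) (R • eOne n)
    have k2 := integral_sub_right_eq_self (μ := volume) (fun x : Rn n => HH m R ‖x‖) (R • eOne n)
    have hj : Integrable (fun x : Rn n =>
        D * (HH m R ‖x + R • eOne n‖ + HH m R ‖x - R • eOne n‖)) := (j1.add j2).const_mul D
    have pw : ∀ x : Rn n, bigF n R x ^ 2 ≤
        D * (HH m R ‖x + R • eOne n‖ + HH m R ‖x - R • eOne n‖) := by
      intro x
      have t1 := (tri n hn hR0 x).1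
      have z1 : 0 ≤ HH m R ‖x + R • eOne n‖ := FF_zero_ge hR1 (norm_nonneg _)
      have z2 : 0 ≤ HH m R ‖x - R • eOne n‖ := FF_zero_ge hR1 (norm_nonneg _)
      rw [hF]
      rcases le_total ‖x + R • eOne n‖ ‖x - R • eOne n‖ with h | h
      · have := FF_upper hc hm hp hmp (norm_nonneg _) h hR1 (by linarith)
        rw [← hD_def] at this
        nlinarith [mul_nonneg hD.le z2]
      · rw [FF_comm]
        have := FF_upper hc hm hp hmp (norm_nonneg _) h hR1 (by linarith)
        rw [← hD_def] at this
        nlinarith [mul_nonneg hD.le z1]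
    have hcont : Continuous (fun x : Rn n => bigF n R x ^ 2) := by
      have hb : ∀ z : Rn n, Continuous (fun x : Rn n => c * (1 + ‖x + z‖ ^ 2) ^ (-m)) := by
        intro z
        refine continuous_const.mul (Continuous.rpow_const (by fun_prop) ?_)
        intro x; left; positivity
      simp only [hF]
      unfold FF
      have b1 := hb (R • eOne n)
      have b2 := hb (-(R • eOne n))
      simp only [← sub_eq_add_neg] at b2
      have hp0 : 0 ≤ p := by linarith
      exact ((((b1.add b2).rpow_const fun _ => Or.inr hp0).sub
        (b1.rpow_const fun _ => Or.inr hp0)).sub (b2.rpow_const fun _ => Or.inr hp0)).pow 2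
    have hint : Integrable (fun x : Rn n => bigF n R x ^ 2) := by
      refine hj.mono' hcont.aestronglyMeasurable (Eventually.of_forall fun x => ?_)
      rw [Real.norm_eq_abs, abs_of_nonneg (sq_nonneg _)]
      exact pw x
    constructor
    · obtain ⟨a2, b2⟩ := piece2 n hn (R ^ (-(4 * m))) hR1
      have a3 := (a2.comp_add_right (R • eOne n)).const_mul E
      have k3 := integral_add_right_eq_self (μ := volume) (fun x : Rn n =>
        ind (Set.Ioc 1 R) (fun r => R ^ (-(4 * m)) * r ^ (-8 : ℝ)) ‖x‖) (R • eOne n)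
      have := integral_mono a3 hint (fun x => by
        simp only
        rw [hF]
        by_cases hx : ‖x + R • eOne n‖ ≤ R
        · obtain ⟨t1, t2⟩ := tri n hn hR0 x
          exact FF_lower hc hm hp hmp (norm_nonneg _) (by linarith) hR1 (by linarith)
        · have : ‖x + R • eOne n‖ ∉ Set.Ioc 1 R := fun h => hx h.2
          unfold ind
          rw [Set.indicator_of_notMem this, mul_zero]; positivity)
      rw [integral_const_mul, k3, b2] at this
      refine le_trans ?_ this
      have : C⁻¹ * gFun n R ^ 2 ≤ R ^ (-(4 * m)) * LL n R := by
        rw [inv_mul_le_iff₀ hC]; exact g2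
      rw [← hW_def]
      gcongr
    · have := integral_mono hint hj pw
      rw [integral_const_mul, integral_add j1 j2, k1, k2, i2, ← hW_def] at this
      refine le_trans this ?_
      have q1 : R ^ (-(4 * m)) / n ≤ gFun n R ^ 2 :=
        (div_le_self (by positivity) (by linarith)).trans g3
      have q2 : R ^ (-((n : ℝ) + 4)) / (n + 4) ≤ gFun n R ^ 2 :=
        (div_le_self (by positivity) (by linarith)).trans g4
      have q3 : R ^ (-(4 * m)) / n + R ^ (-(4 * m)) * LL n R + R ^ (-((n : ℝ) + 4)) / (n + 4)
          ≤ (2 + C) * gFun n R ^ 2 := by linarith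
      calc _ = 2 * D * (W * (R ^ (-(4 * m)) / n + R ^ (-(4 * m)) * LL n R
            + R ^ (-((n : ℝ) + 4)) / (n + 4))) := by ring
        _ ≤ _ := by gcongr
  have hL : ∀ R, LpNorm n 2 (bigF n R) = Real.sqrt (∫ x : Rn n, bigF n R x ^ 2) := by
    intro R
    unfold LpNorm
    rw [Real.sqrt_eq_rpow]
    congr 2
    ext x
    rw [Real.rpow_two, sq_abs]
  set a := E * (W * C⁻¹) with ha_def
  set b := 2 * D * (W * (2 + C)) with hb_def
  have ha : 0 < a := by positivity
  have hb : 0 < b := by positivity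
  refine ⟨1 + (Real.sqrt a)⁻¹ + Real.sqrt b, ?_, 3, by norm_num, fun R hR => ?_⟩
  · have := Real.sqrt_pos.2 hb
    have : 0 < (Real.sqrt a)⁻¹ := inv_pos.2 (Real.sqrt_pos.2 ha)
    linarith [Real.sqrt_nonneg b]
  obtain ⟨m1, m2⟩ := main R hR
  have g0 := (hg R hR).1
  have sa := Real.sqrt_pos.2 ha
  have sb := Real.sqrt_pos.2 hb
  rw [hL]
  constructor
  · apply Real.le_sqrt_of_sq_le
    refine le_trans ?_ m1
    have : (1 + (Real.sqrt a)⁻¹ + Real.sqrt b)⁻¹ ≤ Real.sqrt a := by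
      rw [inv_le_comm₀ (by positivity) sa]; linarith
    calc _ ≤ (Real.sqrt a * gFun n R) ^ 2 := by gcongr
      _ = a * gFun n R ^ 2 := by rw [mul_pow, Real.sq_sqrt ha.le]
      _ = _ := by rw [ha_def]; ring
  · have : Real.sqrt b ≤ 1 + (Real.sqrt a)⁻¹ + Real.sqrt b := by
      have : 0 < (Real.sqrt a)⁻¹ := inv_pos.2 sa
      linarith
    refine le_trans ?_ (mul_le_mul_of_nonneg_right this g0)
    apply Real.sqrt_le_iff.2
    refine ⟨by positivity, le_trans m2 (le_of_eq ?_)⟩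
    rw [mul_pow, Real.sq_sqrt hb.le, hb_def]; ring

end
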